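/- Let [C_1,…,C_r] be the W-characteristic set of ⟨P⟩ under the stated variable ordering and let k < r be the biggest integer such that [C_1,…,C_k] is normal. Let I_{k+1} = ini(C_{k+1}) and y_l = lv(I_{k+1}). If I_{k+1} is R-reduced with respect to C_l, then either res(ini(I_{k+1}), [C_1,…,C_{l−1}]) = 0, or prem(C_{k+1}, [C_1,…,C_{l−1}, I_{k+1}, C_{l+1},…,C_k]) = 0. -/

import Mathlib

open MvPolynomial

namespace CharSets

variable {n : ℕ} {K : Type*} [Field K]

/-- The coefficient of `x_i ^ d` in `F`, as a polynomial in the remaining variables. -/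
noncomputable def coefv (i : Fin n) (d : ℕ) (F : MvPolynomial (Fin n) K) :
    MvPolynomial (Fin n) K :=
  ∑ m ∈ F.support.filter (fun m => m i = d), monomial (Finsupp.erase i m) (F.coeff m)

/-- The leading coefficient of `F` with respect to the variable `x_i`. -/
noncomputable def lcv (i : Fin n) (F : MvPolynomial (Fin n) K) : MvPolynomial (Fin n) K :=
  coefv i (F.degreeOf i) F

/-- Auxiliary pseudo-division: computes (pseudo-quotient, pseudo-remainder) pairs,
with the first argument as fuel; the total power of the leading coefficient used is
exactly the fuel, so that starting with fuel `max(l - m + 1, 0)` yields the pair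
`(Q, R)` of the unique representation `lc(F,x_i)^q • G = Q*F + R` with
`q = max(l - m + 1, 0)` and `deg(R, x_i) < deg(F, x_i)`. -/
noncomputable def pdivAux (i : Fin n) (F : MvPolynomial (Fin n) K) :
    ℕ → MvPolynomial (Fin n) K × MvPolynomial (Fin n) K →
      MvPolynomial (Fin n) K × MvPolynomial (Fin n) K
  | 0, QR => QR
  | q + 1, QR =>
    if (QR.2).degreeOf i < F.degreeOf i then
      (lcv i F ^ (q + 1) * QR.1, lcv i F ^ (q + 1) * QR.2)
    else
      pdivAux i F q
        (lcv i F * QR.1 +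
            coefv i ((QR.2).degreeOf i) QR.2 * X i ^ ((QR.2).degreeOf i - F.degreeOf i),
          lcv i F * QR.2 -
            coefv i ((QR.2).degreeOf i) QR.2 * X i ^ ((QR.2).degreeOf i - F.degreeOf i) * F)

/-- The pseudo-remainder `prem(G, F, x_i)`. -/
noncomputable def prem (G F : MvPolynomial (Fin n) K) (i : Fin n) : MvPolynomial (Fin n) K :=
  (pdivAux i F (G.degreeOf i + 1 - F.degreeOf i) (0, G)).2

/-- The pseudo-quotient `pquo(G, F, x_i)`. -/
noncomputable def pquo (G F : MvPolynomial (Fin n) K) (i : Fin n) : MvPolynomial (Fin n) K :=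
  (pdivAux i F (G.degreeOf i + 1 - F.degreeOf i) (0, G)).1

/-- The class of `P`: the largest index (1-based) of a variable actually occurring in `P`;
the class of a constant is `0`. -/
noncomputable def cls (P : MvPolynomial (Fin n) K) : ℕ :=
  P.vars.sup fun i => (i : ℕ) + 1

/-- The degree of `G` in the leading variable of `P` (`0` if `P` is constant). -/
noncomputable def degLv (G P : MvPolynomial (Fin n) K) : ℕ :=
  if h : P.vars.Nonempty then G.degreeOf (P.vars.max' h) else 0

/-- `G` is R-reduced with respect to `P`, i.e. `deg(G, lv(P)) < deg(P, lv(P))`. -/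
def RReduced (G P : MvPolynomial (Fin n) K) : Prop :=
  degLv G P < degLv P P

/-- The initial of `P`: its leading coefficient w.r.t. its leading variable. -/
noncomputable def ini (P : MvPolynomial (Fin n) K) : MvPolynomial (Fin n) K :=
  if h : P.vars.Nonempty then lcv (P.vars.max' h) P else P

/-- Pseudo-remainder of `G` w.r.t. `F` in the leading variable of `F`
(in case `F` is constant, `m = 0` and the pseudo-remainder is `0`). -/
noncomputable def premLv (G F : MvPolynomial (Fin n) K) : MvPolynomial (Fin n) K :=
  if h : F.vars.Nonempty then prem G F (F.vars.max' h) else 0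

/-- Pseudo-quotient of `G` w.r.t. `F` in the leading variable of `F`. -/
noncomputable def pquoLv (G F : MvPolynomial (Fin n) K) : MvPolynomial (Fin n) K :=
  if h : F.vars.Nonempty then pquo G F (F.vars.max' h) else 0

/-- Iterated pseudo-remainder with respect to a triangular set `[T_1, …, T_r]`:
`prem(P, T) = prem(⋯prem(P, T_r, lv(T_r)), …, T_1, lv(T_1))`. -/
noncomputable def premTS (P : MvPolynomial (Fin n) K) (L : List (MvPolynomial (Fin n) K)) :
    MvPolynomial (Fin n) K :=
  L.foldr (fun T acc => premLv acc T) P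

/-- The Sylvester matrix of `F` and `G` with respect to the variable `x_i`. -/
noncomputable def sylvester (i : Fin n) (F G : MvPolynomial (Fin n) K) :
    Matrix (Fin (G.degreeOf i + F.degreeOf i)) (Fin (G.degreeOf i + F.degreeOf i))
      (MvPolynomial (Fin n) K) :=
  Matrix.of fun r c =>
    if (r : ℕ) < G.degreeOf i then
      if (r : ℕ) ≤ (c : ℕ) ∧ (c : ℕ) ≤ (r : ℕ) + F.degreeOf i then
        coefv i (F.degreeOf i + (r : ℕ) - (c : ℕ)) F
      else 0
    else
      if (r : ℕ) - G.degreeOf i ≤ (c : ℕ) ∧ (c : ℕ) ≤ (r : ℕ) then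
        coefv i (G.degreeOf i + ((r : ℕ) - G.degreeOf i) - (c : ℕ)) G
      else 0

/-- The resultant `res(F, G, x_i)` of `F` and `G` w.r.t. `x_i`
(the determinant of the Sylvester matrix). -/
noncomputable def resv (F G : MvPolynomial (Fin n) K) (i : Fin n) : MvPolynomial (Fin n) K :=
  (sylvester i F G).det

/-- Resultant of `F` and `G` w.r.t. the leading variable of `G`. -/
noncomputable def resLv (F G : MvPolynomial (Fin n) K) : MvPolynomial (Fin n) K :=
  if h : G.vars.Nonempty then resv F G (G.vars.max' h) else F

/-- Iterated resultant with respect to a triangular set: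
`res(F, T) = res(⋯res(F, T_r, lv(T_r)), …, T_1, lv(T_1))`. -/
noncomputable def resTS (F : MvPolynomial (Fin n) K) (L : List (MvPolynomial (Fin n) K)) :
    MvPolynomial (Fin n) K :=
  L.foldr (fun T acc => resLv acc T) F

/-- A triangular set: a nonempty ordered set of nonconstant polynomials with
strictly increasing classes. -/
def TriangularSet (L : List (MvPolynomial (Fin n) K)) : Prop :=
  L ≠ [] ∧ (∀ T ∈ L, 0 < cls T) ∧ L.Chain' fun A B => cls A < cls B

/-- An ascending set: either a single nonzero constant, or a triangular set in which
every later element is R-reduced with respect to every earlier one. -/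
def AscendingSet (L : List (MvPolynomial (Fin n) K)) : Prop :=
  (∃ a : K, a ≠ 0 ∧ L = [MvPolynomial.C a]) ∨
    (TriangularSet L ∧ L.Pairwise fun A B => RReduced B A)

/-- `F` has lower rank than `G`. -/
def rkLT (F G : MvPolynomial (Fin n) K) : Prop :=
  cls F < cls G ∨ (cls F = cls G ∧ 0 < cls F ∧ degLv F F < degLv G G)

/-- `F` and `G` have the same rank: neither has lower rank than the other. -/
def rkEQ (F G : MvPolynomial (Fin n) K) : Prop :=
  ¬ rkLT F G ∧ ¬ rkLT G F

/-- `B` has lower rank than `A` (as ascending sets). -/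
def ascLT (B A : List (MvPolynomial (Fin n) K)) : Prop :=
  (∃ j, j < min A.length B.length ∧
      (∀ i, i < j → rkEQ (A.getD i 0) (B.getD i 0)) ∧ rkLT (B.getD j 0) (A.getD j 0)) ∨
    (A.length < B.length ∧ ∀ i, i < A.length → rkEQ (A.getD i 0) (B.getD i 0))

/-- A Ritt characteristic set of the ideal `I`: an ascending set contained in `I`
of minimal rank among all ascending sets contained in `I`. -/
def RittCharSet (I : Ideal (MvPolynomial (Fin n) K)) (A : List (MvPolynomial (Fin n) K)) :
    Prop :=
  AscendingSet A ∧ (∀ a ∈ A, a ∈ I) ∧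
    ∀ B : List (MvPolynomial (Fin n) K), AscendingSet B → (∀ b ∈ B, b ∈ I) → ¬ ascLT B A

/-- The saturated ideal of a triangular set, as a set of polynomials. -/
def satTS (L : List (MvPolynomial (Fin n) K)) : Set (MvPolynomial (Fin n) K) :=
  {F | ∃ q : ℕ, 0 < q ∧ (L.map ini).prod ^ q * F ∈ Ideal.span {T | T ∈ L}}

/-- A regular set: a triangular set such that `res(ini(T_j), [T_1, …, T_{j-1}]) ≠ 0`
for `j = 2, …, r`. -/
def RegularSet (L : List (MvPolynomial (Fin n) K)) : Prop :=
  TriangularSet L ∧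
    ∀ j : ℕ, 0 < j → j < L.length → resTS (ini (L.getD j 0)) (L.take j) ≠ 0

/-- A normal triangular set: `deg(ini(T_j), lv(T_i)) = 0` for all `i < j`. -/
def NormalSet (L : List (MvPolynomial (Fin n) K)) : Prop :=
  TriangularSet L ∧ L.Pairwise fun A B => degLv (ini B) A = 0

/-- The purely lexicographical order on monomials determined by `x_1 < ⋯ < x_n`. -/
def plexLT (a b : Fin n →₀ ℕ) : Prop :=
  ∃ k : Fin n, a k < b k ∧ ∀ j : Fin n, k < j → a j = b j

/-- `m` is the leading monomial of `P` w.r.t. the plex order. -/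
def IsLpp (P : MvPolynomial (Fin n) K) (m : Fin n →₀ ℕ) : Prop :=
  m ∈ P.support ∧ ∀ m' ∈ P.support, m' ≠ m → plexLT m' m

/-- `G` is the reduced (Buchberger–)Gröbner basis of the ideal `I` w.r.t. the plex
term order determined by `x_1 < ⋯ < x_n`: its elements are nonzero monic members of `I`,
the leading monomial of every nonzero member of `I` is divisible by the leading monomial
of some element of `G`, every element of `G` is B-reduced w.r.t. the others, and `G`
generates `I`. -/
def IsReducedGB (I : Ideal (MvPolynomial (Fin n) K)) (G : Finset (MvPolynomial (Fin n) K)) :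
    Prop :=
  (∀ g ∈ G, g ∈ I ∧ g ≠ 0 ∧ ∀ m, IsLpp g m → g.coeff m = 1) ∧
    (∀ F ∈ I, F ≠ 0 → ∃ g ∈ G, ∃ mg mF, IsLpp g mg ∧ IsLpp F mF ∧ mg ≤ mF) ∧
    (∀ g ∈ G, ∀ g' ∈ G, g' ≠ g → ∀ m ∈ g.support, ∀ m', IsLpp g' m' → ¬ m' ≤ m) ∧
    Ideal.span (G : Set (MvPolynomial (Fin n) K)) = I

/-- `Cs` is the W-characteristic set of `I`: the minimal triangular set contained in the
reduced plex Gröbner basis `G` of `I`, i.e. for each class realized in `G`, `Cs` contains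
the element of that class whose leading monomial is minimal w.r.t. the plex order, the
elements being ordered by increasing class (equivalently, by the plex order). -/
def IsWCharSet (I : Ideal (MvPolynomial (Fin n) K)) (Cs : List (MvPolynomial (Fin n) K)) :
    Prop :=
  ∃ G : Finset (MvPolynomial (Fin n) K), IsReducedGB I G ∧
    (Cs.Chain' fun A B => cls A < cls B) ∧
    (∀ c ∈ Cs, c ∈ G) ∧
    (∀ g ∈ G, ∃ c ∈ Cs, cls c = cls g) ∧
    ∀ c ∈ Cs, ∀ g ∈ G, cls g = cls c → g ≠ c →
      ∃ mc mg, IsLpp c mc ∧ IsLpp g mg ∧ plexLT mc mg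

/-- The set of common zeros of a set `S` of polynomials over `k`, taken in `Kc ^ n`
for an extension `Kc` of `k`. -/
def zeroSet {k : Type*} [Field k] (Kc : Type*) [CommRing Kc] [Algebra k Kc]
    (S : Set (MvPolynomial (Fin n) k)) : Set (Fin n → Kc) :=
  {a | ∀ p ∈ S, MvPolynomial.aeval a p = 0}

theorem degreeOf_eq_zero_iff_mem_supported {j : Fin n} {p : MvPolynomial (Fin n) K} :
    p.degreeOf j = 0 ↔ p ∈ supported K ({j}ᶜ : Set (Fin n)) := by
  rw [mem_supported, Set.subset_compl_singleton_iff, Finset.mem_coe,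
    mem_vars_iff_degreeOf_ne_zero, not_not]

theorem degreeOf_mul_eq_zero {j : Fin n} {p q : MvPolynomial (Fin n) K}
    (hp : p.degreeOf j = 0) (hq : q.degreeOf j = 0) : (p * q).degreeOf j = 0 := by
  have := degreeOf_mul_le j p q
  omega

theorem degreeOf_mul_le_of_degreeOf_eq_zero {j : Fin n} {p : MvPolynomial (Fin n) K}
    (hp : p.degreeOf j = 0) (q : MvPolynomial (Fin n) K) :
    (p * q).degreeOf j ≤ q.degreeOf j := by
  have := degreeOf_mul_le j p q
  omega

theorem degreeOf_pow_eq_zero {j : Fin n} {p : MvPolynomial (Fin n) K}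
    (hp : p.degreeOf j = 0) (k : ℕ) : (p ^ k).degreeOf j = 0 := by
  have := degreeOf_pow_le j p k
  simp_all

theorem degreeOf_eq_zero_of_mul {j : Fin n} {p q : MvPolynomial (Fin n) K}
    (hpq : p * q ≠ 0) (h : (p * q).degreeOf j = 0) : p.degreeOf j = 0 := by
  rw [degreeOf_mul_eq (left_ne_zero_of_mul hpq) (right_ne_zero_of_mul hpq)] at h
  omega

/-- A multivariate polynomial viewed as a univariate polynomial in `x_i`. -/
noncomputable def toUni (i : Fin n) :
    MvPolynomial (Fin n) K →ₐ[K] Polynomial (MvPolynomial (Fin n) K) :=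
  aeval fun j => if j = i then Polynomial.X else Polynomial.C (X j)

theorem toUni_X_self (i : Fin n) :
    toUni i (X i : MvPolynomial (Fin n) K) = Polynomial.X := by simp [toUni]

theorem toUni_monomial (i : Fin n) (m : Fin n →₀ ℕ) (a : K) :
    toUni i (monomial m a) =
      Polynomial.C (monomial (Finsupp.erase i m) a) * Polynomial.X ^ (m i) := by
  have hm : monomial m a = monomial (Finsupp.erase i m) a * X i ^ (m i) := by
    rw [X_pow_eq_monomial, monomial_mul, mul_one, Finsupp.erase_add_single]
  have he : toUni i (monomial (Finsupp.erase i m) a) =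
      Polynomial.C (monomial (Finsupp.erase i m) a) := by
    rw [toUni, aeval_monomial, monomial_eq, map_mul, Finsupp.prod, Finsupp.prod, map_prod]
    congr 1
    refine Finset.prod_congr rfl fun j hj => ?_
    have : j ≠ i := by
      rintro rfl
      simp at hj
    simp [this]
  rw [hm, map_mul, he, map_pow, toUni_X_self]

theorem coeff_toUni (i : Fin n) (d : ℕ) (F : MvPolynomial (Fin n) K) :
    (toUni i F).coeff d = coefv i d F := by
  conv_lhs => rw [F.as_sum]
  rw [map_sum, Polynomial.finsetSum_coeff, coefv, Finset.sum_filter]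
  refine Finset.sum_congr rfl fun m _ => ?_
  rw [toUni_monomial, Polynomial.coeff_C_mul_X_pow]
  simp only [eq_comm]

theorem coefv_coeff_erase (i : Fin n) (F : MvPolynomial (Fin n) K) (m : Fin n →₀ ℕ) :
    (coefv i (m i) F).coeff (Finsupp.erase i m) = F.coeff m := by
  classical
  rw [coefv, coeff_sum]
  simp only [coeff_monomial]
  rw [Finset.sum_eq_single m]
  · simp
  · intro b hb hbm
    rw [if_neg]
    intro h
    apply hbm
    rw [← Finsupp.erase_add_single i b, ← Finsupp.erase_add_single i m, h,
      (Finset.mem_filter.1 hb).2]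
  · intro hm
    have : m ∉ F.support := fun h => hm (Finset.mem_filter.2 ⟨h, rfl⟩)
    simpa using this

theorem exists_of_mem_support_coefv {i : Fin n} {d : ℕ} {F : MvPolynomial (Fin n) K}
    {m : Fin n →₀ ℕ} (hm : m ∈ (coefv i d F).support) :
    ∃ m' ∈ F.support, m' i = d ∧ Finsupp.erase i m' = m := by
  classical
  obtain ⟨m', h, h'⟩ := Finset.mem_biUnion.1 (support_sum hm)
  have := support_monomial_subset h'
  rw [Finset.mem_filter] at h
  exact ⟨m', h.1, h.2, (Finset.mem_singleton.1 this).symm⟩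

theorem degreeOf_coefv_self (i : Fin n) (d : ℕ) (F : MvPolynomial (Fin n) K) :
    (coefv i d F).degreeOf i = 0 := by
  rw [← Nat.le_zero, degreeOf_le_iff]
  intro m hm
  obtain ⟨m', -, -, rfl⟩ := exists_of_mem_support_coefv hm
  simp

theorem degreeOf_coefv_le (i j : Fin n) (d : ℕ) (F : MvPolynomial (Fin n) K) :
    (coefv i d F).degreeOf j ≤ F.degreeOf j := by
  rw [degreeOf_le_iff]
  intro m hm
  obtain ⟨m', h', -, rfl⟩ := exists_of_mem_support_coefv hm
  refine le_trans ?_ (monomial_le_degreeOf j h')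
  rw [Finsupp.erase_apply]
  split_ifs <;> simp

theorem coefv_eq_zero {i : Fin n} {d : ℕ} {F : MvPolynomial (Fin n) K}
    (h : F.degreeOf i < d) : coefv i d F = 0 := by
  rw [coefv, Finset.filter_eq_empty_iff.2, Finset.sum_empty]
  intro m hm
  have := monomial_le_degreeOf i hm
  omega

theorem lcv_ne_zero {i : Fin n} {F : MvPolynomial (Fin n) K} (hF : F ≠ 0) :
    lcv i F ≠ 0 := by
  obtain ⟨m, hm, h⟩ := Finset.exists_mem_eq_sup F.support
    (Finset.nonempty_iff_ne_empty.2 (by simpa using hF)) fun m => m i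
  rw [← degreeOf_eq_sup] at h
  intro h0
  have := coefv_coeff_erase i F m
  rw [← h, ← lcv, h0] at this
  simp at this
  simp [← this] at hm

theorem natDegree_toUni (i : Fin n) (F : MvPolynomial (Fin n) K) :
    (toUni i F).natDegree = F.degreeOf i := by
  rcases eq_or_ne F 0 with rfl | hF
  · simp
  apply le_antisymm
  · rw [Polynomial.natDegree_le_iff_coeff_eq_zero]
    intro N hN
    rw [coeff_toUni, coefv_eq_zero hN]
  · apply Polynomial.le_natDegree_of_ne_zero
    rw [coeff_toUni]
    exact lcv_ne_zero hF

theorem leadingCoeff_toUni (i : Fin n) (F : MvPolynomial (Fin n) K) :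
    (toUni i F).leadingCoeff = lcv i F := by
  rw [Polynomial.leadingCoeff, natDegree_toUni, coeff_toUni, lcv]

theorem toUni_eq_C {i : Fin n} {F : MvPolynomial (Fin n) K} (h : F.degreeOf i = 0) :
    toUni i F = Polynomial.C F := by
  conv_lhs => rw [F.as_sum]
  conv_rhs => rw [F.as_sum]
  rw [map_sum, map_sum]
  refine Finset.sum_congr rfl fun m hm => ?_
  have := monomial_le_degreeOf i hm
  have h0 : m i = 0 := by omega
  rw [toUni_monomial, h0, Finsupp.erase_of_notMem_support (by simpa using h0), pow_zero, mul_one]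

theorem eval_toUni (i : Fin n) (F : MvPolynomial (Fin n) K) :
    (toUni i F).eval (X i) = F := by
  have : ((Polynomial.aeval (X i : MvPolynomial (Fin n) K)).restrictScalars K).comp (toUni i) =
      AlgHom.id K _ := by
    ext j
    by_cases h : j = i
    · subst h; simp [toUni]
    · simp [toUni, h]
  simpa [Polynomial.aeval_def, Polynomial.eval₂_eq_eval_map] using DFunLike.congr_fun this F

theorem coefv_mul_of_degreeOf_eq_zero {i : Fin n} {A : MvPolynomial (Fin n) K}
    (hA : A.degreeOf i = 0) (d : ℕ) (F : MvPolynomial (Fin n) K) :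
    coefv i d (A * F) = A * coefv i d F := by
  rw [← coeff_toUni, map_mul, toUni_eq_C hA, Polynomial.coeff_C_mul, coeff_toUni]

theorem coefv_add (i : Fin n) (d : ℕ) (F G : MvPolynomial (Fin n) K) :
    coefv i d (F + G) = coefv i d F + coefv i d G := by
  simp only [← coeff_toUni, map_add, Polynomial.coeff_add]

theorem coefv_sub (i : Fin n) (d : ℕ) (F G : MvPolynomial (Fin n) K) :
    coefv i d (F - G) = coefv i d F - coefv i d G := by
  simp only [← coeff_toUni, map_sub, Polynomial.coeff_sub]

theorem lcv_mul (i : Fin n) (F G : MvPolynomial (Fin n) K) :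
    lcv i (F * G) = lcv i F * lcv i G := by
  simp only [← leadingCoeff_toUni, map_mul, Polynomial.leadingCoeff_mul]

theorem coefv_mul_X_pow {i : Fin n} {A : MvPolynomial (Fin n) K} (hA : A.degreeOf i = 0)
    (e : ℕ) : coefv i e (A * X i ^ e) = A := by
  rw [← coeff_toUni, map_mul, toUni_eq_C hA, map_pow, toUni_X_self, Polynomial.coeff_C_mul_X_pow,
    if_pos rfl]

theorem degreeOf_lt_of_coefv_eq_zero {i : Fin n} {d : ℕ} {F : MvPolynomial (Fin n) K}
    (hd : 0 < d) (hle : F.degreeOf i ≤ d) (h : coefv i d F = 0) : F.degreeOf i < d := by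
  refine lt_of_le_of_ne hle fun heq => ?_
  have hF : F ≠ 0 := ne_zero_of_degreeOf_ne_zero (i := i) (by omega)
  exact lcv_ne_zero hF (by rw [lcv, heq, h])

theorem coefv_mem_span {i : Fin n} {S : Set (MvPolynomial (Fin n) K)}
    (hS : ∀ T ∈ S, T.degreeOf i = 0) {F : MvPolynomial (Fin n) K} (hF : F ∈ Ideal.span S)
    (d : ℕ) : coefv i d F ∈ Ideal.span S := by
  induction hF using Submodule.span_induction generalizing d with
  | mem x hx =>
    have := coefv_mul_of_degreeOf_eq_zero (hS x hx) d 1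
    rw [mul_one] at this
    rw [this]
    exact Ideal.mul_mem_right _ _ (Ideal.subset_span hx)
  | zero => rw [← coeff_toUni]; simp
  | add x y _ _ hx hy => rw [coefv_add]; exact add_mem (hx d) (hy d)
  | smul a x _ hx =>
    rw [← coeff_toUni, smul_eq_mul, map_mul, Polynomial.coeff_mul]
    refine sum_mem fun p _ => Ideal.mul_mem_left _ _ ?_
    rw [coeff_toUni]
    exact hx _

theorem pdivAux_spec {i : Fin n} {F : MvPolynomial (Fin n) K} (hF : 0 < F.degreeOf i)
    (q : ℕ) (Q R : MvPolynomial (Fin n) K) (hq : R.degreeOf i + 1 ≤ q + F.degreeOf i) :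
    (lcv i F ^ q * R =
        ((pdivAux i F q (Q, R)).1 - lcv i F ^ q * Q) * F + (pdivAux i F q (Q, R)).2) ∧
      (pdivAux i F q (Q, R)).2.degreeOf i < F.degreeOf i ∧
      ∀ j, j ≠ i → F.degreeOf j = 0 →
        (pdivAux i F q (Q, R)).2.degreeOf j ≤ R.degreeOf j ∧
        (pdivAux i F q (Q, R)).1.degreeOf j ≤ max (Q.degreeOf j) (R.degreeOf j) := by
  have hlc : ∀ j, F.degreeOf j = 0 → (lcv i F).degreeOf j = 0 := fun j hj =>
    Nat.le_zero.1 (hj ▸ degreeOf_coefv_le i j _ F)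
  induction q generalizing Q R with
  | zero =>
    refine ⟨by simp [pdivAux], by simp only [pdivAux]; omega, fun j _ _ => by simp [pdivAux]⟩
  | succ q ih =>
    by_cases hlt : R.degreeOf i < F.degreeOf i
    · simp only [pdivAux, if_pos hlt]
      refine ⟨by rw [sub_self, zero_mul, zero_add], ?_, fun j _ hj => ?_⟩
      · exact lt_of_le_of_lt (degreeOf_mul_le_of_degreeOf_eq_zero
          (degreeOf_pow_eq_zero (degreeOf_coefv_self i _ F) _) R) hlt
      · have := degreeOf_pow_eq_zero (hlc j hj) (q + 1)
        exact ⟨degreeOf_mul_le_of_degreeOf_eq_zero this R,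
          (degreeOf_mul_le_of_degreeOf_eq_zero this Q).trans (le_max_left _ _)⟩
    · simp only [pdivAux, if_neg hlt]
      set c := coefv i (R.degreeOf i) R with hc
      set a := R.degreeOf i - F.degreeOf i with ha
      have hcj : ∀ j, c.degreeOf j ≤ R.degreeOf j := fun j => degreeOf_coefv_le i j _ R
      have hX : ∀ j, j ≠ i → (X i ^ a : MvPolynomial (Fin n) K).degreeOf j = 0 :=
        fun j hj => degreeOf_X_pow_of_ne a hj
      have hcX : ∀ j, j ≠ i → (c * X i ^ a).degreeOf j ≤ R.degreeOf j := fun j hj => by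
        have := degreeOf_mul_le j c (X i ^ a)
        have := hX j hj
        have := hcj j
        omega
      have hdeg : (lcv i F * R - c * X i ^ a * F).degreeOf i < R.degreeOf i := by
        have hc0 : c.degreeOf i = 0 := degreeOf_coefv_self i _ R
        refine degreeOf_lt_of_coefv_eq_zero (by omega) ?_ ?_
        · refine (degreeOf_sub_le _ _ _).trans (max_le ?_ ?_)
          · exact degreeOf_mul_le_of_degreeOf_eq_zero (degreeOf_coefv_self i _ F) R
          · rw [mul_assoc]
            refine (degreeOf_mul_le_of_degreeOf_eq_zero hc0 _).trans ?_
            refine (degreeOf_mul_le _ _ _).trans ?_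
            rw [degreeOf_X_self_pow]
            omega
        · rw [coefv_sub, coefv_mul_of_degreeOf_eq_zero (A := lcv i F) (degreeOf_coefv_self i _ F), ← hc,
            mul_assoc, coefv_mul_of_degreeOf_eq_zero hc0, ← coeff_toUni i _ (X i ^ a * F), map_mul,
            map_pow, toUni_X_self]
          have : R.degreeOf i = F.degreeOf i + a := by omega
          conv_lhs => enter [2, 2]; rw [this]
          rw [Polynomial.coeff_X_pow_mul, coeff_toUni, lcv]
          exact sub_eq_zero.2 (mul_comm _ _)
      obtain ⟨h1, h2, h3⟩ := ih (lcv i F * Q + c * X i ^ a) (lcv i F * R - c * X i ^ a * F)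
        (by omega)
      refine ⟨?_, h2, fun j hj hFj => ?_⟩
      · generalize pdivAux i F q _ = A at h1
        linear_combination h1
      · obtain ⟨h4, h5⟩ := h3 j hj hFj
        have hle : (lcv i F * R - c * X i ^ a * F).degreeOf j ≤ R.degreeOf j := by
          refine (degreeOf_sub_le _ _ _).trans (max_le ?_ ?_)
          · exact degreeOf_mul_le_of_degreeOf_eq_zero (hlc j hFj) R
          · have := degreeOf_mul_le j (c * X i ^ a) F
            have := hcX j hj
            omega
        refine ⟨h4.trans hle, h5.trans (max_le ?_ (hle.trans (le_max_right _ _)))⟩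
        refine (degreeOf_add_le _ _ _).trans (max_le_max ?_ (hcX j hj))
        exact degreeOf_mul_le_of_degreeOf_eq_zero (hlc j hFj) Q

theorem exists_prem_spec {i : Fin n} {F : MvPolynomial (Fin n) K} (hF : 0 < F.degreeOf i)
    (G : MvPolynomial (Fin n) K) :
    ∃ Q t, lcv i F ^ t * G = Q * F + prem G F i ∧ (prem G F i).degreeOf i < F.degreeOf i ∧
      ∀ j, j ≠ i → F.degreeOf j = 0 →
        (prem G F i).degreeOf j ≤ G.degreeOf j ∧ Q.degreeOf j ≤ G.degreeOf j := by
  obtain ⟨h1, h2, h3⟩ := pdivAux_spec hF (G.degreeOf i + 1 - F.degreeOf i) 0 G (by omega)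
  exact ⟨pquo G F i, _, by rw [h1, mul_zero, sub_zero]; rfl, h2,
    fun j hj hFj => ⟨(h3 j hj hFj).1, (h3 j hj hFj).2.trans (by simp)⟩⟩

theorem cls_le_iff {P : MvPolynomial (Fin n) K} {c : ℕ} :
    cls P ≤ c ↔ ∀ j : Fin n, c ≤ j → P.degreeOf j = 0 := by
  simp only [cls, Finset.sup_le_iff, mem_vars_iff_degreeOf_ne_zero]
  constructor
  · intro h j hj
    by_contra h0
    have := h j h0
    omega
  · intro h j hj
    by_contra h0
    exact hj (h j (by omega))

theorem cls_le (P : MvPolynomial (Fin n) K) : cls P ≤ n :=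
  cls_le_iff.2 fun j hj => absurd j.2 (by omega)

theorem exists_cls_eq {P : MvPolynomial (Fin n) K} (h : 0 < cls P) :
    ∃ v : Fin n, cls P = v + 1 := by
  have := cls_le P
  exact ⟨⟨cls P - 1, by omega⟩, by simp; omega⟩

theorem degreeOf_eq_zero_of_cls_le {P : MvPolynomial (Fin n) K} {j : Fin n} (h : cls P ≤ j) :
    P.degreeOf j = 0 :=
  cls_le_iff.1 h j le_rfl

theorem degreeOf_pos_of_cls {P : MvPolynomial (Fin n) K} {v : Fin n} (h : cls P = v + 1) :
    0 < P.degreeOf v := by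
  by_contra h0
  have : cls P ≤ v := cls_le_iff.2 fun j hj => by
    rcases eq_or_lt_of_le hj with h' | h'
    · rw [← Fin.ext h']; omega
    · exact degreeOf_eq_zero_of_cls_le (by omega)
  omega

theorem exists_max'_vars {P : MvPolynomial (Fin n) K} {v : Fin n} (h : cls P = v + 1) :
    ∃ hP : P.vars.Nonempty, P.vars.max' hP = v := by
  have hv : v ∈ P.vars := mem_vars_iff_degreeOf_ne_zero.2 (degreeOf_pos_of_cls h).ne'
  refine ⟨⟨v, hv⟩, le_antisymm (Finset.max'_le _ _ _ fun j hj => ?_) (Finset.le_max' _ _ hv)⟩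
  by_contra hlt
  exact mem_vars_iff_degreeOf_ne_zero.1 hj (degreeOf_eq_zero_of_cls_le (by omega))

theorem degLv_eq {P : MvPolynomial (Fin n) K} {v : Fin n} (h : cls P = v + 1)
    (G : MvPolynomial (Fin n) K) : degLv G P = G.degreeOf v := by
  obtain ⟨hP, hv⟩ := exists_max'_vars h
  rw [degLv, dif_pos hP, hv]

theorem ini_eq {P : MvPolynomial (Fin n) K} {v : Fin n} (h : cls P = v + 1) :
    ini P = lcv v P := by
  obtain ⟨hP, hv⟩ := exists_max'_vars h
  rw [ini, dif_pos hP, hv]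

theorem premLv_eq {P : MvPolynomial (Fin n) K} {v : Fin n} (h : cls P = v + 1)
    (G : MvPolynomial (Fin n) K) : premLv G P = prem G P v := by
  obtain ⟨hP, hv⟩ := exists_max'_vars h
  rw [premLv, dif_pos hP, hv]

theorem resLv_eq {P : MvPolynomial (Fin n) K} {v : Fin n} (h : cls P = v + 1)
    (G : MvPolynomial (Fin n) K) : resLv G P = resv G P v := by
  obtain ⟨hP, hv⟩ := exists_max'_vars h
  rw [resLv, dif_pos hP, hv]

theorem rReduced_iff {P : MvPolynomial (Fin n) K} {v : Fin n} (h : cls P = v + 1)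
    {G : MvPolynomial (Fin n) K} : RReduced G P ↔ G.degreeOf v < P.degreeOf v := by
  rw [RReduced, degLv_eq h, degLv_eq h]

theorem exists_premTS_spec (L : List (MvPolynomial (Fin n) K))
    (hL : L.Pairwise fun A B => cls A < cls B) (hpos : ∀ T ∈ L, 0 < cls T)
    (S : Submonoid (MvPolynomial (Fin n) K)) (hS : ∀ T ∈ L, ini T ∈ S)
    (F : MvPolynomial (Fin n) K) :
    (∃ s ∈ S, s * F - premTS F L ∈ Ideal.span {T | T ∈ L}) ∧
      (∀ T ∈ L, RReduced (premTS F L) T) ∧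
      ∀ j, (∀ T ∈ L, T.degreeOf j = 0) → (premTS F L).degreeOf j ≤ F.degreeOf j := by
  induction L with
  | nil => exact ⟨⟨1, S.one_mem, by simp [premTS]⟩, by simp, fun j _ => by simp [premTS]⟩
  | cons A L ih =>
    simp only [List.mem_cons, forall_eq_or_imp, List.pairwise_cons] at hL hpos hS ⊢
    obtain ⟨⟨s, hs, hsF⟩, hred, hdeg⟩ := ih hL.2 hpos.2 hS.2
    obtain ⟨v, hv⟩ := exists_cls_eq hpos.1
    have hpr : premTS F (A :: L) = prem (premTS F L) A v := premLv_eq hv _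
    obtain ⟨Q, t, h1, h2, h3⟩ := exists_prem_spec (degreeOf_pos_of_cls hv) (premTS F L)
    rw [← hpr] at h1 h2 h3
    refine ⟨⟨lcv v A ^ t * s, mul_mem (pow_mem (ini_eq hv ▸ hS.1) t) hs, ?_⟩,
      ⟨(rReduced_iff hv).2 h2, fun T hT => ?_⟩, fun j hj => ?_⟩
    · have : lcv v A ^ t * s * F - premTS F (A :: L) =
          lcv v A ^ t * (s * F - premTS F L) + Q * A := by
        linear_combination h1
      rw [this]
      exact add_mem (Ideal.mul_mem_left _ _ (Ideal.span_mono (fun T hT => Or.inr hT) hsF))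
        (Ideal.mul_mem_left _ _ (Ideal.subset_span (Or.inl rfl)))
    · obtain ⟨w, hw⟩ := exists_cls_eq (hpos.2 T hT)
      have hlt := hL.1 T hT
      have hred' := hred T hT
      rw [rReduced_iff hw] at hred' ⊢
      have hne : w ≠ v := by rintro rfl; omega
      exact (h3 w hne (degreeOf_eq_zero_of_cls_le (by omega))).1.trans_lt hred'
    · have hne : j ≠ v := by
        rintro rfl
        have := degreeOf_pos_of_cls hv
        omega
      exact (h3 j hne hj.1).1.trans (hdeg j hj.2)

theorem sum_coefv_mul_X_pow (i : Fin n) (F : MvPolynomial (Fin n) K) :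
    ∑ d ∈ Finset.range (F.degreeOf i + 1), coefv i d F * X i ^ d = F := by
  conv_rhs => rw [← eval_toUni i F, Polynomial.eval_eq_sum_range, natDegree_toUni]
  simp only [coeff_toUni]

/-- The Sylvester matrix maps the vector of powers of `x_i` to the shifts of `F` and `G`. -/
theorem sylvester_mulVec (i : Fin n) (F G : MvPolynomial (Fin n) K)
    (r : Fin (G.degreeOf i + F.degreeOf i)) :
    (sylvester i F G).mulVec
        (fun c => X i ^ (G.degreeOf i + F.degreeOf i - 1 - (c : ℕ))) r =
      if (r : ℕ) < G.degreeOf i then X i ^ (G.degreeOf i - 1 - (r : ℕ)) * F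
      else X i ^ (F.degreeOf i - 1 - (r - G.degreeOf i : ℕ)) * G := by
  have key : ∀ (H : MvPolynomial (Fin n) K) (a N : ℕ), a + H.degreeOf i < N →
      ∑ c : Fin N, (if a ≤ (c : ℕ) ∧ (c : ℕ) ≤ a + H.degreeOf i then
        coefv i (H.degreeOf i + a - (c : ℕ)) H else 0) * X i ^ (N - 1 - (c : ℕ)) =
      X i ^ (N - 1 - H.degreeOf i - a) * H := by
    intro H a N hN
    rw [Fin.sum_univ_eq_sum_range (fun c => (if a ≤ c ∧ c ≤ a + H.degreeOf i then
        coefv i (H.degreeOf i + a - c) H else 0) * X i ^ (N - 1 - c)) N]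
    simp only [ite_mul, zero_mul]
    rw [← Finset.sum_filter]
    conv_rhs => enter [2]; rw [← sum_coefv_mul_X_pow i H]
    rw [Finset.mul_sum]
    refine Finset.sum_bij' (fun c _ => H.degreeOf i + a - c) (fun d _ => H.degreeOf i + a - d)
      ?_ ?_ ?_ ?_ ?_
    · intro c hc
      simp only [Finset.mem_filter, Finset.mem_range] at hc ⊢
      omega
    · intro d hd
      simp only [Finset.mem_filter, Finset.mem_range] at hd ⊢
      omega
    · intro c hc
      simp only [Finset.mem_filter, Finset.mem_range] at hc
      omega
    · intro d hd
      simp only [Finset.mem_range] at hd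
      omega
    · intro c hc
      simp only [Finset.mem_filter, Finset.mem_range] at hc
      rw [mul_left_comm, ← pow_add]
      congr 2
      omega
  rw [Matrix.mulVec, dotProduct]
  have hr := r.2
  split_ifs with h
  · simp only [sylvester, Matrix.of_apply, if_pos h]
    rw [key F r _ (by omega)]
    congr 2
    omega
  · simp only [sylvester, Matrix.of_apply, if_neg h]
    have := key G (r - G.degreeOf i) (G.degreeOf i + F.degreeOf i) (by omega)
    rw [show (r : ℕ) - G.degreeOf i + G.degreeOf i = r by omega] at this
    rw [this]
    congr 2
    omega

theorem resv_mem_span_pair {i : Fin n} (F : MvPolynomial (Fin n) K) {G : MvPolynomial (Fin n) K}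
    (hG : 0 < G.degreeOf i) : resv F G i ∈ Ideal.span {F, G} := by
  have h := congrFun (congrArg ((sylvester i F G).adjugate.mulVec)
    (funext (sylvester_mulVec i F G))) ⟨G.degreeOf i + F.degreeOf i - 1, by omega⟩
  rw [Matrix.mulVec_mulVec, Matrix.adjugate_mul, Matrix.smul_mulVec, Matrix.one_mulVec] at h
  simp only [Pi.smul_apply, Nat.sub_self, pow_zero, smul_eq_mul, mul_one] at h
  rw [resv, h, Matrix.mulVec, dotProduct]
  refine sum_mem fun c _ => Ideal.mul_mem_left _ _ ?_
  split_ifs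
  · exact Ideal.mul_mem_left _ _ (Ideal.subset_span (Or.inl rfl))
  · exact Ideal.mul_mem_left _ _ (Ideal.subset_span (Or.inr rfl))

theorem degreeOf_resv {i j : Fin n} {F G : MvPolynomial (Fin n) K}
    (h : j = i ∨ F.degreeOf j = 0 ∧ G.degreeOf j = 0) : (resv F G i).degreeOf j = 0 := by
  have hc : ∀ d, coefv i d F ∈ supported K ({j}ᶜ : Set (Fin n)) ∧
      coefv i d G ∈ supported K ({j}ᶜ : Set (Fin n)) := by
    intro d
    rw [← degreeOf_eq_zero_iff_mem_supported, ← degreeOf_eq_zero_iff_mem_supported]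
    rcases h with rfl | h
    · exact ⟨degreeOf_coefv_self _ _ _, degreeOf_coefv_self _ _ _⟩
    · exact ⟨Nat.le_zero.1 (h.1 ▸ degreeOf_coefv_le i j d F),
        Nat.le_zero.1 (h.2 ▸ degreeOf_coefv_le i j d G)⟩
  rw [degreeOf_eq_zero_iff_mem_supported, resv, Matrix.det_apply]
  refine sum_mem fun σ _ => ?_
  rw [Units.smul_def]
  refine zsmul_mem (prod_mem fun c _ => ?_) _
  simp only [sylvester, Matrix.of_apply]
  split_ifs
  · exact (hc _).1
  · exact zero_mem _
  · exact (hc _).2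
  · exact zero_mem _

theorem exists_resTS_sub_mem (L : List (MvPolynomial (Fin n) K)) (hpos : ∀ T ∈ L, 0 < cls T)
    (F : MvPolynomial (Fin n) K) : ∃ q, q * F - resTS F L ∈ Ideal.span {T | T ∈ L} := by
  induction L with
  | nil => exact ⟨1, by simp [resTS]⟩
  | cons A L ih =>
    simp only [List.mem_cons, forall_eq_or_imp] at hpos ⊢
    obtain ⟨q, hq⟩ := ih hpos.2
    obtain ⟨v, hv⟩ := exists_cls_eq hpos.1
    have hr : resTS F (A :: L) = resv (resTS F L) A v := resLv_eq hv _
    obtain ⟨a, b, hab⟩ := Ideal.mem_span_pair.1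
      (resv_mem_span_pair (resTS F L) (degreeOf_pos_of_cls hv))
    refine ⟨a * q, ?_⟩
    have : a * q * F - resTS F (A :: L) = a * (q * F - resTS F L) - b * A := by
      rw [hr, ← hab]; ring
    rw [this]
    exact sub_mem (Ideal.mul_mem_left _ _ (Ideal.span_mono (fun T hT => Or.inr hT) hq))
      (Ideal.mul_mem_left _ _ (Ideal.subset_span (Or.inl rfl)))

theorem degreeOf_resTS (L : List (MvPolynomial (Fin n) K))
    (hL : L.Pairwise fun A B => cls A < cls B) (hpos : ∀ T ∈ L, 0 < cls T)
    (F : MvPolynomial (Fin n) K) (j : Fin n)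
    (h : (∃ T ∈ L, cls T = j + 1) ∨ F.degreeOf j = 0 ∧ ∀ T ∈ L, T.degreeOf j = 0) :
    (resTS F L).degreeOf j = 0 := by
  induction L with
  | nil => simpa [resTS] using h
  | cons A L ih =>
    simp only [List.mem_cons, forall_eq_or_imp, List.pairwise_cons, exists_eq_or_imp]
      at hL hpos h
    obtain ⟨v, hv⟩ := exists_cls_eq hpos.1
    have hr : resTS F (A :: L) = resv (resTS F L) A v := resLv_eq hv _
    rw [hr]
    apply degreeOf_resv
    rcases h with (h | ⟨T, hT, h⟩) | ⟨h1, h2, h3⟩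
    · exact Or.inl (Fin.ext (by omega))
    · have := hL.1 T hT
      exact Or.inr ⟨ih hL.2 hpos.2 (Or.inl ⟨T, hT, h⟩), degreeOf_eq_zero_of_cls_le (by omega)⟩
    · exact Or.inr ⟨ih hL.2 hpos.2 (Or.inr ⟨h1, h3⟩), h2⟩

/-- Setting all variables from `x_v` on to zero. -/
theorem exists_truncation (v : ℕ) : ∃ ψ : MvPolynomial (Fin n) K →ₐ[K] MvPolynomial (Fin n) K,
    (∀ p, cls (ψ p) ≤ v) ∧ ∀ p, cls p ≤ v → ψ p = p := by
  refine ⟨aeval fun j => if (j : ℕ) < v then X j else 0, fun p => ?_, fun p hp => ?_⟩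
  · rw [cls_le_iff]
    intro j hj
    rw [degreeOf_eq_zero_iff_mem_supported]
    induction p using MvPolynomial.induction_on with
    | C a => rw [← algebraMap_eq, AlgHom.commutes]; exact Subalgebra.algebraMap_mem _ _
    | add p q hp hq => rw [map_add]; exact add_mem hp hq
    | mul_X p i hp =>
      rw [map_mul, aeval_X]
      refine mul_mem hp ?_
      split_ifs with h
      · rw [X_mem_supported]
        rintro rfl
        omega
      · exact zero_mem _
  · have : aeval (fun j : Fin n => if (j : ℕ) < v then (X j : MvPolynomial (Fin n) K) else 0) p =
        aeval (X : Fin n → MvPolynomial (Fin n) K) p := by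
      refine eval₂Hom_congr' rfl (fun i hi _ => ?_) rfl
      rw [if_pos]
      by_contra h
      exact mem_vars_iff_degreeOf_ne_zero.1 hi (cls_le_iff.1 hp i (by omega))
    rw [this, aeval_X_left_apply]

theorem plexLT.trans {a b c : Fin n →₀ ℕ} (hab : plexLT a b) (hbc : plexLT b c) : plexLT a c := by
  obtain ⟨i, hi, hi'⟩ := hab
  obtain ⟨j, hj, hj'⟩ := hbc
  rcases lt_trichotomy i j with h | rfl | h
  · exact ⟨j, by rw [hi' j h]; exact hj, fun t ht => (hi' t (h.trans ht)).trans (hj' t ht)⟩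
  · exact ⟨i, hi.trans hj, fun t ht => (hi' t ht).trans (hj' t ht)⟩
  · exact ⟨i, by rw [← hj' i h]; exact hi, fun t ht => (hi' t ht).trans (hj' t (h.trans ht))⟩

theorem not_plexLT_of_le {a b : Fin n →₀ ℕ} (h : b ≤ a) : ¬ plexLT a b := by
  rintro ⟨i, hi, -⟩
  exact absurd (h i) (by omega)

theorem IsLpp.unique {P : MvPolynomial (Fin n) K} {a b : Fin n →₀ ℕ} (ha : IsLpp P a)
    (hb : IsLpp P b) : a = b := by
  by_contra h
  exact not_plexLT_of_le le_rfl ((ha.2 b hb.1 (Ne.symm h)).trans (hb.2 a ha.1 h))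

theorem apply_le_of_plexLT {a b : Fin n →₀ ℕ} {v : Fin n} (h : a = b ∨ plexLT a b)
    (hb : ∀ j, v < j → b j = 0) : a v ≤ b v := by
  rcases h with rfl | ⟨i, hi, hi'⟩
  · exact le_rfl
  · rcases lt_trichotomy v i with h | rfl | h
    · exact absurd (hb i h) (by omega)
    · exact hi.le
    · exact (hi' v h).le

theorem exists_mem_support_apply_eq_degreeOf {F : MvPolynomial (Fin n) K} (hF : F ≠ 0)
    (i : Fin n) : ∃ m ∈ F.support, m i = F.degreeOf i := by
  obtain ⟨m, hm, h⟩ := Finset.exists_mem_eq_sup F.support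
    (Finset.nonempty_iff_ne_empty.2 (by simpa using hF)) fun m => m i
  exact ⟨m, hm, by rw [degreeOf_eq_sup, h]⟩

theorem apply_eq_zero_of_mem_support {F : MvPolynomial (Fin n) K} {m : Fin n →₀ ℕ}
    (hm : m ∈ F.support) {j : Fin n} (h : cls F ≤ j) : m j = 0 := by
  have := monomial_le_degreeOf j hm
  have := degreeOf_eq_zero_of_cls_le h
  omega

/-- A member of the ideal that is reduced with respect to the elements of the W-characteristic
set of smaller class than `F`, and is smaller than `F` in the plex order, vanishes. -/
theorem IsWCharSet.eq_zero_of_rReduced {I : Ideal (MvPolynomial (Fin n) K)}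
    {Cs : List (MvPolynomial (Fin n) K)} (hW : IsWCharSet I Cs) (hpos : ∀ T ∈ Cs, 0 < cls T)
    {F N : MvPolynomial (Fin n) K} (hF : F ∈ Cs) (hN : N ∈ I)
    (hred : ∀ T ∈ Cs, cls T < cls F → RReduced N T)
    (hlt : ∀ m ∈ N.support, ∃ m' ∈ F.support, plexLT m m') : N = 0 := by
  obtain ⟨G, ⟨hG, hdiv, -, -⟩, -, -, hcov, hmin⟩ := hW
  by_contra hN0
  obtain ⟨g, hg, mg, mN, hmg, hmN, hle⟩ := hdiv N hN hN0
  have hdom : ∀ c ∈ Cs, cls c = cls g → ∀ m ∈ c.support, m = mg ∨ plexLT m mg := by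
    intro c hc hcg m hm
    by_cases h : g = c
    · subst h
      exact or_iff_not_imp_left.2 (hmg.2 m hm)
    · obtain ⟨mc, mg', hmc, hmg', hlt'⟩ := hmin c hc g hg hcg.symm h
      rw [hmg'.unique hmg] at hlt'
      by_cases hm' : m = mc
      · exact Or.inr (hm' ▸ hlt')
      · exact Or.inr ((hmc.2 m hm hm').trans hlt')
  obtain ⟨m', hm', hlt'⟩ := hlt mN hmN.1
  obtain ⟨c, hc, hcg⟩ := hcov g hg
  obtain ⟨v, hv⟩ := exists_cls_eq (hpos c hc)
  have hmgv : ∀ j, v < j → mg j = 0 := fun j hj =>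
    apply_eq_zero_of_mem_support hmg.1 (by omega)
  have hcpos := degreeOf_pos_of_cls hv
  obtain ⟨m, hm, hmv⟩ := exists_mem_support_apply_eq_degreeOf
    (ne_zero_of_degreeOf_ne_zero hcpos.ne') v
  have h1 := apply_le_of_plexLT (hdom c hc hcg m hm) hmgv
  have h2 : mg v ≤ mN v := hle v
  rcases lt_trichotomy (cls c) (cls F) with h | h | h
  · have h3 := (rReduced_iff hv).1 (hred c hc h)
    have h4 := monomial_le_degreeOf v hmN.1
    omega
  · rcases hdom F hF (h ▸ hcg) m' hm' with rfl | h'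
    · exact not_plexLT_of_le hle hlt'
    · exact not_plexLT_of_le hle (hlt'.trans h')
  · obtain ⟨i, hi, hi'⟩ := hlt'
    by_cases hiv : i < v
    · have := hi' v hiv
      have := apply_eq_zero_of_mem_support hm' (j := v) (by omega)
      omega
    · have := apply_eq_zero_of_mem_support hm' (j := i) (by omega)
      omega

theorem cls_mul_le {P Q : MvPolynomial (Fin n) K} {c : ℕ} (hP : cls P ≤ c) (hQ : cls Q ≤ c) :
    cls (P * Q) ≤ c := by
  rw [cls_le_iff] at *
  exact fun j hj => degreeOf_mul_eq_zero (hP j hj) (hQ j hj)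

theorem cls_add_le {P Q : MvPolynomial (Fin n) K} {c : ℕ} (hP : cls P ≤ c) (hQ : cls Q ≤ c) :
    cls (P + Q) ≤ c := by
  rw [cls_le_iff] at *
  intro j hj
  have := degreeOf_add_le j P Q
  rw [hP j hj, hQ j hj] at this
  simpa using this

theorem cls_sub_le {P Q : MvPolynomial (Fin n) K} {c : ℕ} (hP : cls P ≤ c) (hQ : cls Q ≤ c) :
    cls (P - Q) ≤ c := by
  rw [cls_le_iff] at *
  intro j hj
  have := degreeOf_sub_le j P Q
  rw [hP j hj, hQ j hj] at this
  simpa using this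

theorem cls_X_pow_le (i : Fin n) (d : ℕ) : cls (X i ^ d : MvPolynomial (Fin n) K) ≤ i + 1 := by
  rw [cls_le_iff]
  intro j hj
  refine degreeOf_X_pow_of_ne d ?_
  rintro rfl
  omega

theorem cls_coefv_le {P : MvPolynomial (Fin n) K} {c : ℕ} (hP : cls P ≤ c) (i : Fin n) (d : ℕ) :
    cls (coefv i d P) ≤ c := by
  rw [cls_le_iff] at *
  exact fun j hj => Nat.le_zero.1 (hP j hj ▸ degreeOf_coefv_le i j d P)

theorem cls_coefv_le_of_cls_eq {P : MvPolynomial (Fin n) K} {i : Fin n} (hP : cls P ≤ i + 1)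
    (d : ℕ) : cls (coefv i d P) ≤ i := by
  rw [cls_le_iff]
  intro j hj
  rcases eq_or_lt_of_le hj with h | h
  · rw [← Fin.ext h]
    exact degreeOf_coefv_self i d P
  · exact degreeOf_eq_zero_of_cls_le ((cls_coefv_le hP i d).trans h)

/-- The nonzero polynomials in the first `M` variables. -/
def params (n : ℕ) (K : Type*) [Field K] (M : ℕ) : Submonoid (MvPolynomial (Fin n) K) where
  carrier := {p | p ≠ 0 ∧ cls p ≤ M}
  one_mem' := ⟨one_ne_zero, by simp [cls]⟩
  mul_mem' ha hb := ⟨mul_ne_zero ha.1 hb.1, cls_mul_le ha.2 hb.2⟩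

theorem mem_params_of_mul {M : ℕ} {p q : MvPolynomial (Fin n) K}
    (h : p * q ∈ params n K M) : p ∈ params n K M :=
  ⟨left_ne_zero_of_mul h.1, cls_le_iff.2 fun j hj =>
    degreeOf_eq_zero_of_mul h.1 (cls_le_iff.1 h.2 j hj)⟩

theorem degreeOf_sub_lcv_mul_X_pow {i : Fin n} {F : MvPolynomial (Fin n) K}
    (hF : 0 < F.degreeOf i) :
    (F - lcv i F * X i ^ F.degreeOf i).degreeOf i < F.degreeOf i := by
  refine degreeOf_lt_of_coefv_eq_zero hF ((degreeOf_sub_le _ _ _).trans (max_le le_rfl ?_)) ?_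
  · refine (degreeOf_mul_le_of_degreeOf_eq_zero (degreeOf_coefv_self i _ F) _).trans ?_
    rw [degreeOf_X_self_pow]
  · rw [coefv_sub, coefv_mul_X_pow (A := lcv i F) (degreeOf_coefv_self i _ F), lcv, sub_self]

theorem degreeOf_mul_X_pow_add {i : Fin n} {A B : MvPolynomial (Fin n) K} {d : ℕ}
    (hA : A.degreeOf i = 0) (hA0 : A ≠ 0) (hB : B.degreeOf i < d) :
    (A * X i ^ d + B).degreeOf i = d ∧ lcv i (A * X i ^ d + B) = A := by
  have h : (A * X i ^ d).degreeOf i = d := by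
    rw [degreeOf_mul_X_self_pow_eq_add_of_ne_zero i d hA0, hA, zero_add]
  have h' : (A * X i ^ d + B).degreeOf i = d := by
    rw [degreeOf_add_eq_of_degreeOf_lt (h.symm ▸ hB), h]
  refine ⟨h', ?_⟩
  rw [lcv, h', coefv_add, coefv_mul_X_pow hA, coefv_eq_zero hB, add_zero]

/-- If the initial of `I` is invertible modulo `L`, then `I` is associated modulo `L` to a
polynomial whose initial involves only parameters. -/
theorem exists_normalized {M : ℕ} {v : Fin n} {L : List (MvPolynomial (Fin n) K)}
    (hL : L.Pairwise fun A B => cls A < cls B) (hpos : ∀ T ∈ L, 0 < cls T)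
    (hv : ∀ T ∈ L, cls T ≤ v) (hcov : ∀ j : Fin n, M ≤ j → j < v → ∃ T ∈ L, cls T = j + 1)
    {I : MvPolynomial (Fin n) K} (hI : cls I = v + 1) (hres : resTS (ini I) L ≠ 0) :
    ∃ J q r, r ∈ params n K M ∧ lcv v J = r ∧ J.degreeOf v = I.degreeOf v ∧ cls J ≤ v + 1 ∧
      cls q ≤ v ∧ J - q * I ∈ Ideal.span {T | T ∈ L} ∧
      ini I * J - r * I ∈ Ideal.span {T | T ∈ L} := by
  have hini : cls (ini I) ≤ v := by
    rw [ini_eq hI]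
    exact cls_coefv_le_of_cls_eq hI.le _
  set r := resTS (ini I) L with hr
  have hrp : r ∈ params n K M := by
    refine ⟨hres, cls_le_iff.2 fun j hj => degreeOf_resTS L hL hpos _ j ?_⟩
    by_cases h : j < v
    · exact Or.inl (hcov j hj h)
    · refine Or.inr ⟨degreeOf_eq_zero_of_cls_le (by omega), fun T hT => ?_⟩
      have := hv T hT
      exact degreeOf_eq_zero_of_cls_le (by omega)
  obtain ⟨q₀, hq₀⟩ := exists_resTS_sub_mem L hpos (ini I)
  rw [← hr] at hq₀
  obtain ⟨ψ, hψ, hψ'⟩ := exists_truncation (n := n) (K := K) v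
  have hrcls : cls r ≤ v := cls_le_iff.2 fun j hj =>
    degreeOf_resTS L hL hpos _ j (Or.inr ⟨degreeOf_eq_zero_of_cls_le (by omega), fun T hT => by
      have := hv T hT
      exact degreeOf_eq_zero_of_cls_le (by omega)⟩)
  have hrv : r.degreeOf v = 0 := degreeOf_eq_zero_of_cls_le hrcls
  have hq : ψ q₀ * ini I - r ∈ Ideal.span {T | T ∈ L} := by
    have h := Ideal.mem_map_of_mem ψ hq₀
    rw [map_sub, map_mul, hψ' _ hini, hψ' _ hrcls, Ideal.map_span] at h
    refine Ideal.span_mono ?_ h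
    rintro _ ⟨T, hT, rfl⟩
    change ψ T ∈ L
    rwa [hψ' T (hv T hT)]
  set q := ψ q₀
  set d := I.degreeOf v
  have hd0 : 0 < d := degreeOf_pos_of_cls hI
  have htail := degreeOf_sub_lcv_mul_X_pow hd0
  have hqv : q.degreeOf v = 0 := degreeOf_eq_zero_of_cls_le (hψ q₀)
  obtain ⟨h1, h2⟩ := degreeOf_mul_X_pow_add hrv hres
    ((degreeOf_mul_le_of_degreeOf_eq_zero hqv (I - lcv v I * X v ^ d)).trans_lt htail)
  have hJI : (r * X v ^ d + q * (I - lcv v I * X v ^ d)) - q * I ∈ Ideal.span {T | T ∈ L} := by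
    rw [← ini_eq hI]
    have : (r * X v ^ d + q * (I - ini I * X v ^ d)) - q * I =
        - X v ^ d * (q * ini I - r) := by ring
    rw [this]
    exact Ideal.mul_mem_left _ _ hq
  refine ⟨_, q, r, hrp, h2, h1, ?_, hψ q₀, hJI, ?_⟩
  · refine cls_add_le (cls_mul_le (hrcls.trans (Nat.le_succ _)) (cls_X_pow_le v d))
      (cls_mul_le ((hψ q₀).trans (by omega))
        (cls_sub_le hI.le (cls_mul_le (cls_coefv_le hI.le v _) (cls_X_pow_le v d))))
  · have : ini I * (r * X v ^ d + q * (I - lcv v I * X v ^ d)) - r * I =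
      ini I * ((r * X v ^ d + q * (I - lcv v I * X v ^ d)) - q * I) + I * (q * ini I - r) := by
        ring
    rw [this]
    exact add_mem (Ideal.mul_mem_left _ _ hJI) (Ideal.mul_mem_left _ _ hq)

/-- Pseudo-division by a polynomial whose initial involves only parameters. -/
theorem exists_pseudo_quotient {M : ℕ} {v : Fin n} (hM : M ≤ v) {D J : MvPolynomial (Fin n) K}
    (hD : cls D = v + 1) (hDi : ini D ∈ params n K M) (hJ : cls J ≤ v + 1)
    (hJ0 : 0 < J.degreeOf v) (hJi : lcv v J ∈ params n K M) (hlt : J.degreeOf v < D.degreeOf v) :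
    ∃ c ∈ params n K M, ∃ H S, c * D = H * J + S ∧ S.degreeOf v < J.degreeOf v ∧
      H.degreeOf v + J.degreeOf v = D.degreeOf v ∧ lcv v H ∈ params n K M ∧
      cls H ≤ v + 1 ∧ cls S ≤ v + 1 := by
  obtain ⟨H, t, h1, h2, h3⟩ := exists_prem_spec hJ0 D
  have hc : lcv v J ^ t ∈ params n K M := pow_mem hJi t
  have hc0 : (lcv v J ^ t).degreeOf v = 0 := cls_le_iff.1 hc.2 v hM
  have hD0 : D ≠ 0 := ne_zero_of_degreeOf_ne_zero (degreeOf_pos_of_cls hD).ne'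
  have hdeg : (lcv v J ^ t * D).degreeOf v = D.degreeOf v := by
    rw [degreeOf_mul_eq hc.1 hD0, hc0, zero_add]
  have hHJ : H * J = lcv v J ^ t * D - prem D J v := by rw [h1]; ring
  have hHJdeg : (H * J).degreeOf v = D.degreeOf v := by
    rw [hHJ, sub_eq_add_neg, degreeOf_add_eq_of_degreeOf_lt, hdeg]
    rw [degreeOf_neg, hdeg]
    exact h2.trans hlt
  have hHJ0 : H * J ≠ 0 := ne_zero_of_degreeOf_ne_zero (i := v) (by omega)
  have hl : lcv v H * lcv v J ∈ params n K M := by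
    rw [← lcv_mul, lcv, hHJdeg, hHJ, coefv_sub, coefv_eq_zero (F := prem D J v) (h2.trans hlt),
      sub_zero, coefv_mul_of_degreeOf_eq_zero hc0]
    exact mul_mem hc (by rwa [ini_eq hD] at hDi)
  refine ⟨_, hc, H, _, h1, h2, ?_, mem_params_of_mul hl, ?_, ?_⟩
  · rw [← hHJdeg, degreeOf_mul_eq (left_ne_zero_of_mul hHJ0) (right_ne_zero_of_mul hHJ0)]
  · refine cls_le_iff.2 fun j hj => ?_
    have := h3 j (by rintro rfl; omega) (cls_le_iff.1 hJ j hj)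
    have := cls_le_iff.1 hD.le j hj
    omega
  · refine cls_le_iff.2 fun j hj => ?_
    have := h3 j (by rintro rfl; omega) (cls_le_iff.1 hJ j hj)
    have := cls_le_iff.1 hD.le j hj
    omega

theorem exists_plexLT_of_degreeOf_lt {v : Fin n} {F : MvPolynomial (Fin n) K} (hF : cls F = v + 1)
    {m : Fin n →₀ ℕ} (hm : ∀ j, v < j → m j = 0) (hlt : m v < F.degreeOf v) :
    ∃ m' ∈ F.support, plexLT m m' := by
  obtain ⟨m', hm', h⟩ := exists_mem_support_apply_eq_degreeOf (F := F)
    (ne_zero_of_degreeOf_ne_zero (degreeOf_pos_of_cls hF).ne') v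
  refine ⟨m', hm', v, by omega, fun j hj => ?_⟩
  rw [hm j hj, apply_eq_zero_of_mem_support hm' (by omega)]

theorem exists_plexLT_of_degreeOf_ini_lt {v w : Fin n} (hvw : v < w)
    {F : MvPolynomial (Fin n) K} (hF : cls F = w + 1) (hI : cls (ini F) = v + 1)
    {m : Fin n →₀ ℕ} (hm : ∀ j, v < j → j ≠ w → m j = 0) (hmw : m w = F.degreeOf w)
    (hlt : m v < (ini F).degreeOf v) : ∃ m' ∈ F.support, plexLT m m' := by
  obtain ⟨m₀, hm₀, h⟩ := exists_mem_support_apply_eq_degreeOf (F := ini F)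
    (ne_zero_of_degreeOf_ne_zero (degreeOf_pos_of_cls hI).ne') v
  have hm₀' := hm₀
  rw [ini_eq hF] at hm₀'
  obtain ⟨m', hm', h1, rfl⟩ := exists_of_mem_support_coefv hm₀'
  refine ⟨m', hm', v, ?_, fun j hj => ?_⟩
  · rw [Finsupp.erase_ne hvw.ne] at h
    omega
  · rcases eq_or_ne j w with rfl | hjw
    · rw [hmw, h1]
    · rw [hm j hj hjw, ← Finsupp.erase_ne hjw]
      exact (apply_eq_zero_of_mem_support hm₀ (by omega)).symm

theorem rReduced_mono {N X T : MvPolynomial (Fin n) K} (hT : 0 < cls T) (hX : RReduced X T)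
    (h : ∀ j : Fin n, cls T = j + 1 → N.degreeOf j ≤ X.degreeOf j) : RReduced N T := by
  obtain ⟨w, hw⟩ := exists_cls_eq hT
  rw [rReduced_iff hw] at hX ⊢
  exact (h w hw).trans_lt hX

theorem rReduced_of_cls_lt {N T : MvPolynomial (Fin n) K} (h : cls N < cls T) :
    RReduced N T := by
  obtain ⟨w, hw⟩ := exists_cls_eq (Nat.zero_lt_of_lt h)
  rw [rReduced_iff hw, degreeOf_eq_zero_of_cls_le (P := N) (by omega)]
  exact degreeOf_pos_of_cls hw

theorem rReduced_add {N X T : MvPolynomial (Fin n) K} (hT : 0 < cls T) (hN : RReduced N T)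
    (hX : RReduced X T) : RReduced (N + X) T := by
  obtain ⟨w, hw⟩ := exists_cls_eq hT
  rw [rReduced_iff hw] at *
  exact (degreeOf_add_le _ _ _).trans_lt (max_lt hN hX)

theorem premTS_eq_zero {M : ℕ} {v w : Fin n} (hM : M ≤ v) (hvw : v < w)
    {L₁ L₂ : List (MvPolynomial (Fin n) K)} {D F : MvPolynomial (Fin n) K}
    {𝔭 : Ideal (MvPolynomial (Fin n) K)}
    (hsort : (L₁ ++ D :: L₂).Pairwise fun A B => cls A < cls B)
    (hL₁ : ∀ T ∈ L₁, M < cls T) (hD : cls D = v + 1) (hL₂ : ∀ T ∈ L₂, cls T ≤ w)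
    (hcov : ∀ j : Fin n, M ≤ j → j < v → ∃ T ∈ L₁, cls T = j + 1)
    (hini : ∀ T ∈ L₁ ++ D :: L₂, ini T ∈ params n K M)
    (hmem : ∀ T ∈ L₁ ++ D :: L₂, T ∈ 𝔭) (hF : F ∈ 𝔭) (hFw : cls F = w + 1)
    (hI : cls (ini F) = v + 1) (hIred : (ini F).degreeOf v < D.degreeOf v)
    (hmin : ∀ N ∈ 𝔭, (∀ T ∈ L₁ ++ D :: L₂, RReduced N T) →
      (∀ m ∈ N.support, ∃ m' ∈ F.support, plexLT m m') → N = 0)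
    (hres : resTS (ini (ini F)) L₁ ≠ 0) : premTS F (L₁ ++ ini F :: L₂) = 0 := by
  have hsort' := hsort
  rw [List.pairwise_append, List.pairwise_cons] at hsort'
  obtain ⟨hs₁, ⟨hsD, hs₂⟩, hs₁₂⟩ := hsort'
  have hL₁v : ∀ T ∈ L₁, cls T ≤ v := fun T hT => by
    have := hs₁₂ T hT D List.mem_cons_self
    omega
  have hL₁p : ∀ T ∈ L₁, 0 < cls T := fun T hT => Nat.zero_lt_of_lt (hL₁ T hT)
  have hLw : ∀ T ∈ L₁ ++ D :: L₂, 0 < cls T ∧ cls T ≤ w := by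
    intro T hT
    rw [List.mem_append, List.mem_cons] at hT
    rcases hT with hT | rfl | hT
    · have := hL₁ T hT
      have := hL₁v T hT
      omega
    · omega
    · have := hsD T hT
      have := hL₂ T hT
      omega
  have hspan : ∀ {L : List (MvPolynomial (Fin n) K)}, (∀ T ∈ L, T ∈ L₁ ++ D :: L₂) →
      ∀ {x}, x ∈ Ideal.span {T | T ∈ L} → x ∈ 𝔭 := fun hL x hx =>
    Ideal.span_le.2 (fun T hT => hmem T (hL T hT)) hx
  have hmem₁ : ∀ T ∈ L₁, T ∈ L₁ ++ D :: L₂ := fun T hT => List.mem_append_left _ hT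
  have hDmem : D ∈ L₁ ++ D :: L₂ := by simp
  set I := ini F
  have hIw : lcv w F = I := (ini_eq hFw).symm
  have he : 0 < F.degreeOf w := degreeOf_pos_of_cls hFw
  set e := F.degreeOf w
  -- reduced members of the ideal of small degree in `x_w` vanish
  have hsmall : ∀ N ∈ 𝔭, (∀ T ∈ L₁ ++ D :: L₂, RReduced N T) → cls N ≤ w + 1 →
      N.degreeOf w < e → N = 0 := by
    intro N hN hred hcls hdeg
    refine hmin N hN hred fun m hm => exists_plexLT_of_degreeOf_lt hFw ?_ ?_
    · exact fun j hj => apply_eq_zero_of_mem_support hm (by omega)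
    · exact (monomial_le_degreeOf w hm).trans_lt hdeg
  obtain ⟨J, q, r, hr, hJr, hJdeg, hJcls, hq, hJI, hIJ⟩ :=
    exists_normalized hs₁ hL₁p hL₁v hcov hI hres
  have hId : 0 < I.degreeOf v := degreeOf_pos_of_cls hI
  obtain ⟨c, hc, H, S, hHS, hSdeg, hHdeg, hHl, hHcls, hScls⟩ :=
    exists_pseudo_quotient hM hD (hini D hDmem) hJcls (hJdeg ▸ hId) (hJr ▸ hr) (hJdeg ▸ hIred)
  rw [hJdeg] at hSdeg hHdeg
  obtain ⟨⟨s, hs, hsS⟩, hSred, hSle⟩ := exists_premTS_spec L₁ hs₁ hL₁p (params n K M)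
    (fun T hT => hini T (hmem₁ T hT)) S
  set S₁ := premTS S L₁
  have hfree₁ : ∀ j : Fin n, (v : ℕ) ≤ j → ∀ T ∈ L₁, T.degreeOf j = 0 := fun j hj T hT =>
    degreeOf_eq_zero_of_cls_le ((hL₁v T hT).trans hj)
  have hS₁deg : S₁.degreeOf v < I.degreeOf v := (hSle v (hfree₁ v le_rfl)).trans_lt hSdeg
  have hS₁cls : cls S₁ ≤ v + 1 := cls_le_iff.2 fun j hj =>
    Nat.le_zero.1 (cls_le_iff.1 hScls j hj ▸ hSle j (hfree₁ j (by omega)))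
  have hS₁0 : S₁ = 0 := by
    obtain ⟨⟨s', hs', hW⟩, hWred, hWle⟩ := exists_premTS_spec (L₁ ++ D :: L₂) hsort
      (fun T hT => (hLw T hT).1) (params n K M) hini (s * q * H * (F - I * X w ^ e))
    set W := premTS (s * q * H * (F - I * X w ^ e)) (L₁ ++ D :: L₂)
    have hfree : ∀ j : Fin n, (w : ℕ) ≤ j → ∀ T ∈ L₁ ++ D :: L₂, T.degreeOf j = 0 :=
      fun j hj T hT => degreeOf_eq_zero_of_cls_le ((hLw T hT).2.trans hj)
    have hsqH : cls (s * q * H) ≤ w := cls_mul_le (cls_mul_le (hs.2.trans (by omega))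
      (hq.trans (by omega))) (hHcls.trans (by omega))
    have hWdeg : W.degreeOf w < e := by
      refine (hWle w (hfree w le_rfl)).trans_lt ?_
      refine (degreeOf_mul_le_of_degreeOf_eq_zero (degreeOf_eq_zero_of_cls_le hsqH) _).trans_lt ?_
      rw [← hIw]
      exact degreeOf_sub_lcv_mul_X_pow he
    have hWcls : cls W ≤ w + 1 := by
      refine cls_le_iff.2 fun j hj => Nat.le_zero.1 ((hWle j (hfree j (by omega))).trans ?_)
      rw [Nat.le_zero]
      refine cls_le_iff.1 (cls_mul_le (hsqH.trans (by omega)) (cls_sub_le hFw.le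
        (cls_mul_le (hI.le.trans (by omega)) (cls_X_pow_le w e)))) j hj
    have hsS₁ : cls (-s' * S₁) ≤ v + 1 := by
      rw [neg_mul, ← zero_sub]
      exact cls_sub_le (by simp [cls]) (cls_mul_le (hs'.2.trans (by omega)) hS₁cls)
    have hsS₁deg : (-s' * S₁).degreeOf v < I.degreeOf v := by
      rw [neg_mul, degreeOf_neg]
      exact (degreeOf_mul_le_of_degreeOf_eq_zero (cls_le_iff.1 hs'.2 v hM) _).trans_lt hS₁deg
    have hsS₁w : (-s' * S₁).degreeOf w = 0 := degreeOf_eq_zero_of_cls_le (hsS₁.trans hvw)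
    have hN : -s' * S₁ * X w ^ e + W = 0 := by
      refine hmin _ ?_ ?_ ?_
      · have : -s' * S₁ * X w ^ e + W = s' * s * q * H * F
            - (s' * (s * q * H * (F - I * X w ^ e)) - W)
            + s' * X w ^ e * s * H * (J - q * I) - s' * X w ^ e * s * c * D
            + s' * X w ^ e * (s * S - S₁) := by
          linear_combination s' * X w ^ e * s * hHS
        rw [this]
        exact add_mem (sub_mem (add_mem (sub_mem (Ideal.mul_mem_left _ _ hF)
          (hspan (fun T hT => hT) hW)) (Ideal.mul_mem_left _ _ (hspan hmem₁ hJI)))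
          (Ideal.mul_mem_left _ _ (hmem D hDmem))) (Ideal.mul_mem_left _ _ (hspan hmem₁ hsS))
      · intro T hT
        obtain ⟨hTp, hTw⟩ := hLw T hT
        refine rReduced_add hTp ?_ (hWred T hT)
        have hTred : RReduced (-s' * S₁) T := by
          rw [List.mem_append, List.mem_cons] at hT
          rcases hT with hT | rfl | hT
          · refine rReduced_mono hTp (hSred T hT) fun j hj => ?_
            have := hL₁ T hT
            rw [neg_mul, degreeOf_neg]
            exact degreeOf_mul_le_of_degreeOf_eq_zero (cls_le_iff.1 hs'.2 j (by omega)) _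
          · rw [rReduced_iff hD]
            exact hsS₁deg.trans hIred
          · refine rReduced_of_cls_lt (hsS₁.trans_lt ?_)
            have := hsD T hT
            omega
        refine rReduced_mono hTp hTred fun j hj => ?_
        rw [mul_comm]
        refine degreeOf_mul_le_of_degreeOf_eq_zero (degreeOf_X_pow_of_ne _ ?_) _
        rintro rfl
        omega
      · intro m hm
        rcases Finset.mem_union.1 (support_add hm) with hm | hm
        · rw [mem_support_iff, X_pow_eq_monomial, coeff_mul_monomial'] at hm
          split_ifs at hm with hle
          · rw [mul_one, ← mem_support_iff] at hm
            have hsub : ∀ j, m j = (m - Finsupp.single w e) j + Finsupp.single w e j := fun j => by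
              have := hle j
              rw [Finsupp.tsub_apply]
              omega
            refine exists_plexLT_of_degreeOf_ini_lt hvw hFw hI (fun j hj hjw => ?_) ?_ ?_
            · rw [hsub j, apply_eq_zero_of_mem_support hm (by omega),
                Finsupp.single_eq_of_ne hjw, zero_add]
            · rw [hsub w, apply_eq_zero_of_mem_support hm (by omega), Finsupp.single_eq_same,
                zero_add]
            · rw [hsub v, Finsupp.single_eq_of_ne hvw.ne, add_zero]
              exact (monomial_le_degreeOf v hm).trans_lt hsS₁deg
          · exact absurd rfl hm
        · refine exists_plexLT_of_degreeOf_lt hFw ?_ ?_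
          · exact fun j hj => apply_eq_zero_of_mem_support hm (by omega)
          · exact (monomial_le_degreeOf w hm).trans_lt hWdeg
    have h := congrArg (coefv w e) hN
    rw [coefv_add, coefv_mul_X_pow hsS₁w, coefv_eq_zero hWdeg,
      coefv_eq_zero (F := 0) (by simpa using he), add_zero, neg_mul, neg_eq_zero] at h
    exact (mul_eq_zero.1 h).resolve_left hs'.1
  rw [hS₁0, sub_zero] at hsS
  have hp : r * s ∈ params n K M := mul_mem hr hs
  have hHI : r * s * H * I ∈ 𝔭 := by
    have : r * s * H * I = s * ini I * c * D - ini I * (s * S) - s * H * (ini I * J - r * I) := by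
      linear_combination - s * ini I * hHS
    rw [this]
    exact sub_mem (sub_mem (Ideal.mul_mem_left _ _ (hmem D hDmem))
      (Ideal.mul_mem_left _ _ (hspan hmem₁ hsS))) (Ideal.mul_mem_left _ _ (hspan hmem₁ hIJ))
  have hcancel : ∀ Y, r * s * H * Y ∈ 𝔭 → (∀ T ∈ L₁, RReduced Y T) → (∀ T ∈ L₂, RReduced Y T) →
      Y.degreeOf v < I.degreeOf v → Y.degreeOf w < e → cls Y ≤ w + 1 → Y = 0 := by
    intro Y hY hY₁ hY₂ hYv hYw hYcls
    have hHfree : ∀ j : Fin n, v < j → H.degreeOf j = 0 := fun j hj =>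
      cls_le_iff.1 hHcls j hj
    obtain ⟨⟨t, ht, htN⟩, hNred, hNle⟩ := exists_premTS_spec L₁ hs₁ hL₁p (params n K M)
      (fun T hT => hini T (hmem₁ T hT)) (H * Y)
    set N := premTS (H * Y) L₁
    have hNle' : ∀ j, v < j → N.degreeOf j ≤ Y.degreeOf j := fun j hj =>
      (hNle j (hfree₁ j hj.le)).trans (degreeOf_mul_le_of_degreeOf_eq_zero (hHfree j hj) Y)
    have hpN : r * s * N ∈ 𝔭 := by
      have : r * s * N = t * (r * s * H * Y) - r * s * (t * (H * Y) - N) := by ring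
      rw [this]
      exact sub_mem (Ideal.mul_mem_left _ _ hY) (Ideal.mul_mem_left _ _ (hspan hmem₁ htN))
    have hple : ∀ {p}, p ∈ params n K M → ∀ (A : MvPolynomial (Fin n) K) (j : Fin n), M ≤ j →
        (p * A).degreeOf j ≤ A.degreeOf j := fun hp A j hj =>
      degreeOf_mul_le_of_degreeOf_eq_zero (cls_le_iff.1 hp.2 j hj) A
    have hN0 : N = 0 := by
      refine (mul_eq_zero.1 (hsmall _ hpN ?_ ?_ ?_)).resolve_left hp.1
      · intro T hT
        have hTp := (hLw T hT).1
        rw [List.mem_append, List.mem_cons] at hT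
        rcases hT with hT | rfl | hT
        · have := hL₁ T hT
          exact rReduced_mono hTp (hNred T hT) fun j hj => hple hp _ j (by omega)
        · rw [rReduced_iff hD]
          refine (hple hp _ v hM).trans_lt ?_
          have := hNle v (hfree₁ v le_rfl)
          have := degreeOf_mul_le v H Y
          omega
        · have := hsD T hT
          exact rReduced_mono hTp (hY₂ T hT) fun j hj =>
            (hple hp _ j (by omega)).trans (hNle' j (by omega))
      · refine cls_mul_le (hp.2.trans (by omega)) (cls_le_iff.2 fun j hj => ?_)
        have := hNle' j (by omega)
        rw [cls_le_iff.1 hYcls j hj] at this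
        omega
      · exact ((hple hp _ w (by omega)).trans (hNle' w hvw)).trans_lt hYw
    rw [hN0, sub_zero] at htN
    by_contra hY0
    have htop := coefv_mem_span (i := v) (hfree₁ v le_rfl) htN ((t * (H * Y)).degreeOf v)
    have htv : lcv v t = t := by
      have := cls_le_iff.1 ht.2 v hM
      rw [lcv, this, ← coeff_toUni, toUni_eq_C this, Polynomial.coeff_C_zero]
    rw [← lcv, lcv_mul, lcv_mul, htv, ← mul_assoc] at htop
    have hp' : t * lcv v H ∈ params n K M := mul_mem ht hHl
    have hle : ∀ j, (lcv v Y).degreeOf j ≤ Y.degreeOf j := fun j => degreeOf_coefv_le v j _ Y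
    refine mul_ne_zero hp'.1 (lcv_ne_zero (i := v) hY0)
      (hsmall _ (hspan hmem₁ htop) (fun T hT => ?_) ?_ ?_)
    · have hTp := (hLw T hT).1
      rw [List.mem_append, List.mem_cons] at hT
      rcases hT with hT | rfl | hT
      · have := hL₁ T hT
        exact rReduced_mono hTp (hY₁ T hT) fun j hj => (hple hp' _ j (by omega)).trans (hle j)
      · rw [rReduced_iff hD]
        exact ((hple hp' _ v hM).trans (hle v)).trans_lt (hYv.trans hIred)
      · have := hsD T hT
        exact rReduced_mono hTp (hY₂ T hT) fun j hj => (hple hp' _ j (by omega)).trans (hle j)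
    · exact cls_mul_le (hp'.2.trans (by omega)) (cls_coefv_le hYcls v _)
    · exact ((hple hp' _ w (by omega)).trans (hle w)).trans_lt hYw
  have hsortI : (L₁ ++ I :: L₂).Pairwise fun A B => cls A < cls B := by
    rw [List.pairwise_append, List.pairwise_cons]
    refine ⟨hs₁, ⟨fun T hT => by rw [hI, ← hD]; exact hsD T hT, hs₂⟩, fun A hA B hB => ?_⟩
    rcases List.mem_cons.1 hB with rfl | hB
    · rw [hI, ← hD]
      exact hs₁₂ A hA D List.mem_cons_self
    · exact hs₁₂ A hA B (List.mem_cons_of_mem _ hB)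
  have hIw' : ∀ T ∈ L₁ ++ I :: L₂, 0 < cls T ∧ cls T ≤ w := by
    intro T hT
    rw [List.mem_append, List.mem_cons] at hT
    rcases hT with hT | rfl | hT
    · exact hLw T (hmem₁ T hT)
    · omega
    · exact hLw T (by simp [hT])
  have hfreeI : ∀ j : Fin n, (w : ℕ) ≤ j → ∀ T ∈ L₁ ++ I :: L₂, T.degreeOf j = 0 :=
    fun j hj T hT => degreeOf_eq_zero_of_cls_le ((hIw' T hT).2.trans hj)
  obtain ⟨⟨g, hg, hgR⟩, hRred, hRle⟩ := exists_premTS_spec (L₁ ++ I :: L₂) hsortI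
    (fun T hT => (hIw' T hT).1) (supported K ({w}ᶜ : Set (Fin n))).toSubmonoid (fun T hT =>
      degreeOf_eq_zero_iff_mem_supported.1 (by
        obtain ⟨u, hu⟩ := exists_cls_eq (hIw' T hT).1
        rw [ini_eq hu]
        exact degreeOf_eq_zero_of_cls_le ((cls_coefv_le le_rfl u _).trans (hIw' T hT).2))) F
  set R := premTS F (L₁ ++ I :: L₂)
  have hgw : g.degreeOf w = 0 := degreeOf_eq_zero_iff_mem_supported.2 hg
  have hmulspan : ∀ {x}, x ∈ Ideal.span {T | T ∈ L₁ ++ I :: L₂} → r * s * H * x ∈ 𝔭 := by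
    intro x hx
    induction hx using Submodule.span_induction with
    | mem x hx =>
      rcases List.mem_append.1 hx with hx | hx
      · exact Ideal.mul_mem_left _ _ (hmem x (hmem₁ x hx))
      · rcases List.mem_cons.1 hx with rfl | hx
        · exact hHI
        · exact Ideal.mul_mem_left _ _ (hmem x (by simp [hx]))
    | zero => simp
    | add x y _ _ hx hy => rw [mul_add]; exact add_mem hx hy
    | smul a x _ hx =>
      rw [smul_eq_mul, mul_left_comm]
      exact Ideal.mul_mem_left _ _ hx
  have hR₁ : ∀ T ∈ L₁, RReduced R T := fun T hT => hRred T (by simp [hT])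
  have hR₂ : ∀ T ∈ L₂, RReduced R T := fun T hT => hRred T (by simp [hT])
  have hRv : R.degreeOf v < I.degreeOf v := (rReduced_iff hI).1 (hRred I (by simp))
  have hRcls : cls R ≤ w + 1 := cls_le_iff.2 fun j hj => by
    have := hRle j (hfreeI j (by omega))
    rw [cls_le_iff.1 hFw.le j hj] at this
    omega
  have hRtop : coefv w e R = 0 := by
    have hle : ∀ j, (coefv w e R).degreeOf j ≤ R.degreeOf j := fun j => degreeOf_coefv_le w j _ R
    refine hcancel _ ?_ (fun T hT => ?_) (fun T hT => ?_) ((hle v).trans_lt hRv) ?_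
      (cls_coefv_le hRcls w e)
    · apply hmulspan
      have h := coefv_mem_span (hfreeI w le_rfl) hgR e
      rw [coefv_sub, coefv_mul_of_degreeOf_eq_zero hgw, ← lcv, hIw] at h
      have hgI : g * I ∈ Ideal.span {T | T ∈ L₁ ++ I :: L₂} :=
        Ideal.mul_mem_left _ _ (Ideal.subset_span (by simp))
      simpa using sub_mem hgI h
    · exact rReduced_mono (hL₁p T hT) (hR₁ T hT) fun j _ => hle j
    · exact rReduced_mono (hLw T (by simp [hT])).1 (hR₂ T hT) fun j _ => hle j
    · rw [degreeOf_coefv_self]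
      exact he
  have hRw : R.degreeOf w < e :=
    degreeOf_lt_of_coefv_eq_zero he (hRle w (hfreeI w le_rfl)) hRtop
  refine hcancel R ?_ hR₁ hR₂ hRv hRw hRcls
  have h := sub_mem (Ideal.mul_mem_left 𝔭 (r * s * H * g) hF) (hmulspan hgR)
  convert h using 1
  ring

/-- Lemma mainlem1. Let `[C_1, …, C_r]` be the W-characteristic set of
`⟨P⟩` under the variable ordering in which the leading variables of the `C_i` are the `r`
greatest variables, and let `k < r` be the biggest integer such that `[C_1, …, C_k]` is
normal. Let `I_{k+1} = ini(C_{k+1})` and `y_l = lv(I_{k+1})`. If `I_{k+1}` is R-reduced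
with respect to `C_l`, then either `res(ini(I_{k+1}), [C_1, …, C_{l−1}]) = 0`, or
`prem(C_{k+1}, [C_1, …, C_{l−1}, I_{k+1}, C_{l+1}, …, C_k]) = 0`.
(0-based indexing: `C_{k+1} = Cs.getD k 0`, `C_l = Cs.getD l 0`,
`[C_1, …, C_{l−1}] = Cs.take l`, `[C_{l+1}, …, C_k] = (Cs.drop (l+1)).take (k−l−1)`.) -/
theorem statement16 {n : ℕ} {K : Type*} [Field K]
    (P : Finset (MvPolynomial (Fin n) K)) (hne : P.Nonempty) (h0 : ∀ p ∈ P, p ≠ 0)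
    (hproper : Ideal.span (P : Set (MvPolynomial (Fin n) K)) ≠ ⊤)
    (Cs : List (MvPolynomial (Fin n) K))
    (hW : IsWCharSet (Ideal.span (P : Set (MvPolynomial (Fin n) K))) Cs)
    (hord : ∀ i, i < Cs.length → cls (Cs.getD i 0) = n - Cs.length + i + 1)
    (k : ℕ) (hkr : k < Cs.length)
    (hnorm : NormalSet (Cs.take k))
    (hmax : ¬ NormalSet (Cs.take (k + 1)))
    (l : ℕ) (hl : l < Cs.length)
    (hlv : cls (ini (Cs.getD k 0)) = cls (Cs.getD l 0))
    (hred : RReduced (ini (Cs.getD k 0)) (Cs.getD l 0)) :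
    resTS (ini (ini (Cs.getD k 0))) (Cs.take l) = 0 ∨
      premTS (Cs.getD k 0)
        (Cs.take l ++ [ini (Cs.getD k 0)] ++ (Cs.drop (l + 1)).take (k - l - 1)) = 0 := by
  refine or_iff_not_imp_left.2 fun hres => ?_
  have hlast := hord (Cs.length - 1) (by omega)
  have hn := cls_le (Cs.getD (Cs.length - 1) 0)
  set M := n - Cs.length
  have hgetD : ∀ i, i < Cs.length → Cs.getD i 0 ∈ Cs := fun i hi => by
    rw [List.getD_eq_getElem _ _ hi]
    exact List.getElem_mem hi
  have hgetD_take : ∀ m i, i < m → i < Cs.length → Cs.getD i 0 ∈ Cs.take m :=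
    fun m i him hi => by
      rw [List.getD_eq_getElem _ _ hi]
      exact List.mem_take_iff_getElem.2 ⟨i, by omega, rfl⟩
  have htake : ∀ m, ∀ T ∈ Cs.take m, ∃ i < Cs.length, i < m ∧ Cs.getD i 0 = T := by
    intro m T hT
    obtain ⟨i, hi, rfl⟩ := List.mem_take_iff_getElem.1 hT
    exact ⟨i, by omega, by omega, List.getD_eq_getElem _ _ _⟩
  have hpos : ∀ T ∈ Cs, 0 < cls T := fun T hT => by
    obtain ⟨i, hi, rfl⟩ := List.mem_iff_getElem.1 hT
    have := hord i hi
    rw [List.getD_eq_getElem _ _ hi] at this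
    omega
  have hsort : (Cs.take k).Pairwise fun A B => cls A < cls B := by
    refine List.Pairwise.sublist (List.take_sublist _ _) ?_
    rw [List.pairwise_iff_getElem]
    intro i j hi hj hij
    have hi' := hord i hi
    have hj' := hord j hj
    rw [List.getD_eq_getElem _ _ hi] at hi'
    rw [List.getD_eq_getElem _ _ hj] at hj'
    omega
  have hmemI : ∀ T ∈ Cs, T ∈ Ideal.span (P : Set (MvPolynomial (Fin n) K)) := by
    obtain ⟨G, ⟨hG, -⟩, -, hCG, -⟩ := hW
    exact fun T hT => (hG T (hCG T hT)).1
  have hFk := hord k hkr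
  have hDl := hord l hl
  obtain ⟨w, hw⟩ := exists_cls_eq (hpos _ (hgetD k hkr))
  obtain ⟨v, hv⟩ := exists_cls_eq (hpos _ (hgetD l hl))
  have hlk : l < k := by
    have := cls_coefv_le_of_cls_eq hw.le ((Cs.getD k 0).degreeOf w)
    rw [← lcv, ← ini_eq hw] at this
    omega
  have hvM : (v : ℕ) = M + l := by omega
  have hwM : (w : ℕ) = M + k := by omega
  have hsplit : Cs.take k =
      Cs.take l ++ Cs.getD l 0 :: (Cs.drop (l + 1)).take (k - l - 1) := by
    obtain ⟨d, rfl⟩ := Nat.exists_eq_add_of_lt hlk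
    rw [add_assoc, List.take_add, List.drop_eq_getElem_cons hl, List.take_succ_cons,
      List.getD_eq_getElem _ _ hl]
    congr 3
    omega
  have hini : ∀ T ∈ Cs.take k, ini T ∈ params n K M := by
    intro T hT
    obtain ⟨i, hi, hik, rfl⟩ := htake k T hT
    obtain ⟨u, hu⟩ := exists_cls_eq (hpos _ (hgetD i hi))
    have hui := hord i hi
    refine ⟨?_, cls_le_iff.2 fun j hj => ?_⟩
    · rw [ini_eq hu]
      exact lcv_ne_zero (ne_zero_of_degreeOf_ne_zero (degreeOf_pos_of_cls hu).ne')
    · by_cases hju : (u : ℕ) ≤ j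
      · rw [ini_eq hu]
        exact degreeOf_eq_zero_of_cls_le ((cls_coefv_le_of_cls_eq hu.le _).trans hju)
      · have hjl : (j : ℕ) - M < (Cs.take k).length := by
          rw [List.length_take]
          omega
        have h := List.pairwise_iff_getElem.1 hnorm.2 (j - M) i hjl
          (by rw [List.length_take]; omega) (by omega)
        rw [List.getElem_take, List.getElem_take, ← List.getD_eq_getElem _ 0,
          ← List.getD_eq_getElem _ 0, degLv_eq (v := j)] at h
        · exact h
        · rw [hord _ (by omega)]
          omega
  rw [List.append_assoc, List.singleton_append]
  refine premTS_eq_zero (M := M) (v := v) (w := w) (D := Cs.getD l 0)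
    (𝔭 := Ideal.span (P : Set (MvPolynomial (Fin n) K))) (by omega) (by omega)
    (hsplit ▸ hsort) (fun T hT => ?_) hv (fun T hT => ?_) (fun j hMj hjv => ?_)
    (hsplit ▸ hini) (fun T hT => ?_) (hmemI _ (hgetD k hkr)) hw (hlv.trans hv)
    ((rReduced_iff hv).1 hred) (fun N hN hNred hNlt => ?_) hres
  · obtain ⟨i, hi, -, rfl⟩ := htake l T hT
    have := hord i hi
    omega
  · obtain ⟨i, hi, hik, rfl⟩ := htake k T (hsplit ▸ by simp [hT])
    have := hord i hi
    omega
  · refine ⟨_, hgetD_take l (j - M) (by omega) (by omega), ?_⟩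
    rw [hord _ (by omega)]
    omega
  · exact hmemI T (List.mem_of_mem_take (hsplit ▸ hT))
  · refine hW.eq_zero_of_rReduced hpos (hgetD k hkr) hN (fun T hT hlt => hNred T ?_) hNlt
    obtain ⟨i, hi, rfl⟩ := List.mem_iff_getElem.1 hT
    rw [← List.getD_eq_getElem _ 0] at hlt ⊢
    rw [hord i hi, hFk] at hlt
    exact hsplit ▸ hgetD_take k i (by omega) hi

end CharSets
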